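/- A sequence of positive finite Borel measures μ_n converges to μ in the generalized Wasserstein distance W_p^{a,b} if and only if μ_n converges to μ weakly-* (against continuous bounded functions) and the family {μ_n} is tight. -/

import Mathlib

open MeasureTheory Set
open scoped ENNReal NNReal

noncomputable section

abbrev Rd (d : ℕ) := EuclideanSpace ℝ (Fin d)

/-- Transference plans: probability measures on the product with normalized marginals. -/
def IsPlan {d : ℕ} (μ ν : Measure (Rd d)) (π : Measure (Rd d × Rd d)) : Prop :=
  IsProbabilityMeasure π ∧ π.map Prod.fst = (μ Set.univ)⁻¹ • μ ∧
    π.map Prod.snd = (ν Set.univ)⁻¹ • ν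

/-- Cost of a plan. -/
def planCost {d : ℕ} (p : ℝ) (π : Measure (Rd d × Rd d)) : ℝ≥0∞ :=
  ∫⁻ q, (edist q.1 q.2) ^ p ∂π

/-- Mass-scaled Wasserstein distance `W_p(μ,ν) = |μ| (inf_π ∫ |x-y|^p dπ)^{1/p}`. -/
def Wp {d : ℕ} (p : ℝ) (μ ν : Measure (Rd d)) : ℝ≥0∞ :=
  μ Set.univ * (⨅ π : {π : Measure (Rd d × Rd d) // IsPlan μ ν π}, planCost p π.1) ^ (1/p)

/-- Total variation norm `|μ - ν|` of the difference of two measures. -/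
def tv {d : ℕ} (μ ν : Measure (Rd d)) : ℝ≥0∞ := (μ - ν) Set.univ + (ν - μ) Set.univ

/-- Finite mass and finite `p`-th moment. -/
def finMom {d : ℕ} (p : ℝ) (μ : Measure (Rd d)) : Prop :=
  IsFiniteMeasure μ ∧ ∫⁻ x, (‖x‖₊ : ℝ≥0∞) ^ p ∂μ ≠ ⊤

/-- The functional `T_p^{a,b}`. -/
def Tab {d : ℕ} (a b p : ℝ) (μ ν : Measure (Rd d)) : ℝ≥0∞ :=
  ⨅ (μ' : Measure (Rd d)) (ν' : Measure (Rd d)) (_ : IsFiniteMeasure μ')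
    (_ : IsFiniteMeasure ν') (_ : μ' Set.univ = ν' Set.univ),
    ENNReal.ofReal a ^ p * (tv μ μ' + tv ν ν') ^ p + ENNReal.ofReal b ^ p * Wp p μ' ν' ^ p

/-- The generalized Wasserstein distance `W_p^{a,b}`. -/
def Wab {d : ℕ} (a b p : ℝ) (μ ν : Measure (Rd d)) : ℝ≥0∞ := Tab a b p μ ν ^ (1/p)

/-- Tightness of a family of measures. -/
def Tight {d : ℕ} (M : Set (Measure (Rd d))) : Prop :=
  ∀ ε : ℝ≥0∞, 0 < ε → ∃ K : Set (Rd d), IsCompact K ∧ ∀ μ ∈ M, μ Kᶜ < ε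


lemma le_sub_add_meas {α : Type*} [MeasurableSpace α] (μ ν : Measure α) [IsFiniteMeasure μ]
    [IsFiniteMeasure ν] : μ ≤ (μ - ν) + ν := by
  obtain ⟨s, hs⟩ := exists_isHahnDecomposition μ ν
  have h1 := hs.le_on
  have h2 := hs.ge_on_compl
  have hm := hs.measurableSet
  have h3 : (μ - ν).restrict sᶜ + ν.restrict sᶜ = μ.restrict sᶜ := by
    rw [Measure.restrict_sub_eq_restrict_sub_restrict hm.compl,
      Measure.sub_add_cancel_of_le h2]
  rw [← Measure.restrict_add_restrict_compl (μ := μ) hm, ← h3]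
  calc μ.restrict s + ((μ - ν).restrict sᶜ + ν.restrict sᶜ)
      ≤ ν.restrict s + ((μ - ν) + ν.restrict sᶜ) := by
        gcongr
        exact Measure.restrict_le_self
    _ = (μ - ν) + (ν.restrict s + ν.restrict sᶜ) := add_left_comm _ _ _
    _ = (μ - ν) + ν := by rw [Measure.restrict_add_restrict_compl hm]
    _ = _ := by rw [h3, Measure.restrict_add_restrict_compl hm]

lemma tv_comm' {d : ℕ} (μ ν : Measure (Rd d)) : tv μ ν = tv ν μ := add_comm _ _

lemma lintegral_le_tv {d : ℕ} (μ ν : Measure (Rd d)) [IsFiniteMeasure μ] [IsFiniteMeasure ν]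
    (f : Rd d → ℝ≥0∞) (C : ℝ≥0∞) (hC : ∀ x, f x ≤ C) :
    ∫⁻ x, f x ∂μ ≤ ∫⁻ x, f x ∂ν + C * tv μ ν := by
  calc ∫⁻ x, f x ∂μ ≤ ∫⁻ x, f x ∂((μ - ν) + ν) :=
        lintegral_mono' (le_sub_add_meas μ ν) le_rfl
    _ = ∫⁻ x, f x ∂ν + ∫⁻ x, f x ∂(μ - ν) := by rw [lintegral_add_measure, add_comm]
    _ ≤ ∫⁻ x, f x ∂ν + ∫⁻ x, C ∂(μ - ν) := by gcongr; exact hC _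
    _ ≤ _ := by
        rw [lintegral_const]
        unfold tv
        gcongr
        exact le_self_add

lemma tv_le_of_add {d : ℕ} (μ ν ρ : Measure (Rd d)) (h : μ = ν + ρ) : tv μ ν ≤ ρ univ := by
  unfold tv
  have h1 : μ - ν ≤ ρ := Measure.sub_le_of_le_add (by rw [h, add_comm])
  have h2 : ν - μ = 0 := Measure.sub_eq_zero_of_le (by rw [h]; exact Measure.le_add_right le_rfl)
  rw [h2]
  simpa using h1 univ

/-- Duality-type estimate. -/
lemma le_Wp {d : ℕ} (p : ℝ) (hp : 1 ≤ p) (μ ν : Measure (Rd d)) [IsFiniteMeasure μ]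
    [IsFiniteMeasure ν] (hm : μ univ = ν univ) (u₁ u₂ v₁ v₂ : Rd d → ℝ≥0∞)
    (hu₁ : Measurable u₁) (hu₂ : Measurable u₂) (hv₁ : Measurable v₁) (hv₂ : Measurable v₂)
    (L : ℝ≥0∞) (hL0 : L ≠ 0) (hL : L ≠ ⊤)
    (h : ∀ x y, u₁ x + v₁ y ≤ u₂ x + v₂ y + L * edist x y) :
    ∫⁻ x, u₁ x ∂μ + ∫⁻ y, v₁ y ∂ν ≤ ∫⁻ x, u₂ x ∂μ + ∫⁻ y, v₂ y ∂ν + L * Wp p μ ν := by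
  have hp0 : 0 < p := by linarith
  by_cases hμ0 : μ univ = 0
  · have h1 : μ = 0 := Measure.measure_univ_eq_zero.1 hμ0
    have h2 : ν = 0 := Measure.measure_univ_eq_zero.1 (hm ▸ hμ0)
    simp [h1, h2]
  have hμt : μ univ ≠ ⊤ := measure_ne_top _ _
  -- the estimate for one plan
  have key : ∀ π, IsPlan μ ν π → ∫⁻ x, u₁ x ∂μ + ∫⁻ y, v₁ y ∂ν ≤
      ∫⁻ x, u₂ x ∂μ + ∫⁻ y, v₂ y ∂ν + L * (μ univ * (planCost p π) ^ (1/p)) := by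
    rintro π ⟨hπ, hπ1, hπ2⟩
    have e1 : ∀ w : Rd d → ℝ≥0∞, Measurable w →
        ∫⁻ x, w x ∂μ = μ univ * ∫⁻ q, w q.1 ∂π := by
      intro w hw
      have : ∫⁻ q, w q.1 ∂π = ∫⁻ x, w x ∂(π.map Prod.fst) :=
        (lintegral_map hw measurable_fst).symm
      rw [this, hπ1, lintegral_smul_measure, smul_eq_mul, ← mul_assoc,
        ENNReal.mul_inv_cancel hμ0 hμt, one_mul]
    have e2 : ∀ w : Rd d → ℝ≥0∞, Measurable w →
        ∫⁻ x, w x ∂ν = μ univ * ∫⁻ q, w q.2 ∂π := by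
      intro w hw
      have : ∫⁻ q, w q.2 ∂π = ∫⁻ x, w x ∂(π.map Prod.snd) :=
        (lintegral_map hw measurable_snd).symm
      rw [this, hπ2, lintegral_smul_measure, smul_eq_mul, ← mul_assoc, ← hm,
        ENNReal.mul_inv_cancel hμ0 hμt, one_mul]
    have e3 : ∫⁻ q, edist q.1 q.2 ∂π ≤ (planCost p π) ^ (1/p) := by
      have := eLpNorm'_le_eLpNorm'_of_exponent_le (f := fun q : Rd d × Rd d => dist q.1 q.2)
        zero_lt_one hp π (by fun_prop)
      simp only [eLpNorm', ENNReal.rpow_one, div_one] at this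
      have h4 : ∀ q : Rd d × Rd d, ‖dist q.1 q.2‖ₑ = edist q.1 q.2 := by
        intro q
        rw [Real.enorm_eq_ofReal dist_nonneg, edist_dist]
      simpa only [h4, planCost] using this
    rw [e1 u₁ hu₁, e1 u₂ hu₂, e2 v₁ hv₁, e2 v₂ hv₂]
    calc μ univ * ∫⁻ q, u₁ q.1 ∂π + μ univ * ∫⁻ q, v₁ q.2 ∂π
        = μ univ * ∫⁻ q, (u₁ q.1 + v₁ q.2) ∂π := by
          rw [lintegral_add_left (by fun_prop), mul_add]
      _ ≤ μ univ * ∫⁻ q, (u₂ q.1 + v₂ q.2 + L * edist q.1 q.2) ∂π := by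
          gcongr μ univ * ?_
          exact lintegral_mono fun q => h _ _
      _ = μ univ * (∫⁻ q, u₂ q.1 ∂π + ∫⁻ q, v₂ q.2 ∂π + L * ∫⁻ q, edist q.1 q.2 ∂π) := by
          rw [lintegral_add_left (by fun_prop), lintegral_add_left (by fun_prop),
            lintegral_const_mul _ (by fun_prop)]
      _ ≤ μ univ * (∫⁻ q, u₂ q.1 ∂π + ∫⁻ q, v₂ q.2 ∂π + L * (planCost p π) ^ (1/p)) := by
          gcongr
      _ = _ := by ring
  have hW : Wp p μ ν = ⨅ π : {π : Measure (Rd d × Rd d) // IsPlan μ ν π},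
      μ univ * (planCost p π.1) ^ (1/p) := by
    unfold Wp
    rw [ENNReal.mul_iInf_of_ne hμ0 hμt |>.symm]
    congr 1
    have := (ENNReal.orderIsoRpow (1/p) (by positivity)).map_iInf
      (fun π : {π : Measure (Rd d × Rd d) // IsPlan μ ν π} => planCost p π.1)
    exact this
  rw [hW, ENNReal.mul_iInf_of_ne hL0 hL, ENNReal.add_iInf]
  exact le_iInf fun π => key π.1 π.2

lemma exists_of_Wab_lt {d : ℕ} (a b p : ℝ) (ha : 0 < a) (hb : 0 < b) (hp : 1 ≤ p)
    (μ ν : Measure (Rd d)) (r : ℝ≥0∞) (h : Wab a b p μ ν < r) :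
    ∃ μ' ν' : Measure (Rd d), IsFiniteMeasure μ' ∧ IsFiniteMeasure ν' ∧ μ' univ = ν' univ ∧
      tv μ μ' + tv ν ν' ≤ r / ENNReal.ofReal a ∧ Wp p μ' ν' ≤ r / ENNReal.ofReal b := by
  have hp0 : 0 < p := by linarith
  have h1 : Tab a b p μ ν < r ^ p := by
    have := ENNReal.rpow_lt_rpow h hp0
    rwa [Wab, ← ENNReal.rpow_mul, one_div, inv_mul_cancel₀ hp0.ne', ENNReal.rpow_one] at this
  unfold Tab at h1
  simp only [iInf_lt_iff] at h1
  obtain ⟨μ', ν', i1, i2, hm, hlt⟩ := h1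
  refine ⟨μ', ν', i1, i2, hm, ?_, ?_⟩
  · rw [ENNReal.le_div_iff_mul_le (by simp [ha]) (by simp), mul_comm]
    rw [← ENNReal.rpow_le_rpow_iff hp0, ENNReal.mul_rpow_of_nonneg _ _ hp0.le]
    exact le_self_add.trans hlt.le
  · rw [ENNReal.le_div_iff_mul_le (by simp [hb]) (by simp), mul_comm]
    rw [← ENNReal.rpow_le_rpow_iff hp0, ENNReal.mul_rpow_of_nonneg _ _ hp0.le]
    exact le_add_self.trans hlt.le

lemma two_sided {d : ℕ} (p : ℝ) (hp : 1 ≤ p)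
    (μ ν μ' ν' : Measure (Rd d)) [IsFiniteMeasure μ] [IsFiniteMeasure ν] [IsFiniteMeasure μ']
    [IsFiniteMeasure ν'] (hm : μ' univ = ν' univ) (f g : Rd d → ℝ≥0∞) (hf : Measurable f)
    (hg : Measurable g) (L C : ℝ≥0∞) (hL0 : L ≠ 0) (hL : L ≠ ⊤) (hfC : ∀ x, f x ≤ C)
    (hgC : ∀ x, g x ≤ C)
    (h1 : ∀ x y, f x ≤ f y + g y + L * edist x y)
    (h2 : ∀ x y, f y ≤ f x + g y + L * edist x y) (S : ℝ≥0∞)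
    (hS : ∫⁻ y, g y ∂ν + 3 * C * (tv μ μ' + tv ν ν') + L * Wp p μ' ν' ≤ S) :
    ∫⁻ x, f x ∂μ ≤ ∫⁻ x, f x ∂ν + S ∧ ∫⁻ x, f x ∂ν ≤ ∫⁻ x, f x ∂μ + S := by
  set T := tv μ μ' + tv ν ν' with hT
  have t1 : tv μ μ' ≤ T := le_self_add
  have t2 : tv ν ν' ≤ T := le_add_self
  have t3 : tv μ' μ ≤ T := by rw [tv_comm']; exact t1
  have t4 : tv ν' ν ≤ T := by rw [tv_comm']; exact t2
  have a1 := le_Wp p hp μ' ν' hm f 0 0 (f + g) hf measurable_zero measurable_zero (hf.add hg)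
    L hL0 hL (by simpa using h1)
  have a2 := le_Wp p hp μ' ν' hm 0 f f g measurable_zero hf hf hg
    L hL0 hL (by simpa using h2)
  simp only [Pi.zero_apply, lintegral_zero, add_zero, zero_add, Pi.add_apply] at a1 a2
  rw [lintegral_add_left hf] at a1
  have b1 := lintegral_le_tv μ μ' f C hfC
  have b2 := lintegral_le_tv ν ν' f C hfC
  have b3 := lintegral_le_tv μ' μ f C hfC
  have b4 := lintegral_le_tv ν' ν f C hfC
  have b5 := lintegral_le_tv ν' ν g C hgC
  constructor
  · calc ∫⁻ x, f x ∂μ ≤ ∫⁻ x, f x ∂μ' + C * T := b1.trans (by gcongr)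
      _ ≤ (∫⁻ x, f x ∂ν' + ∫⁻ x, g x ∂ν' + L * Wp p μ' ν') + C * T := by gcongr
      _ ≤ ((∫⁻ x, f x ∂ν + C * T) + (∫⁻ x, g x ∂ν + C * T) + L * Wp p μ' ν') + C * T := by
        gcongr
        · exact b4.trans (by gcongr)
        · exact b5.trans (by gcongr)
      _ = ∫⁻ x, f x ∂ν + (∫⁻ y, g y ∂ν + 3 * C * T + L * Wp p μ' ν') := by ring
      _ ≤ _ := by gcongr
  · calc ∫⁻ x, f x ∂ν ≤ ∫⁻ x, f x ∂ν' + C * T := b2.trans (by gcongr)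
      _ ≤ (∫⁻ x, f x ∂μ' + ∫⁻ x, g x ∂ν' + L * Wp p μ' ν') + C * T := by gcongr
      _ ≤ ((∫⁻ x, f x ∂μ + C * T) + (∫⁻ x, g x ∂ν + C * T) + L * Wp p μ' ν') + C * T := by
        gcongr
        · exact b3.trans (by gcongr)
        · exact b5.trans (by gcongr)
      _ = ∫⁻ x, f x ∂μ + (∫⁻ y, g y ∂ν + 3 * C * T + L * Wp p μ' ν') := by ring
      _ ≤ _ := by gcongr

lemma exists_compact_meas {d : ℕ} (ν : Measure (Rd d)) [IsFiniteMeasure ν] (ε : ℝ≥0∞)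
    (hε : 0 < ε) : ∃ K : Set (Rd d), IsCompact K ∧ ν Kᶜ < ε := by
  obtain ⟨e, he0, he⟩ := exists_between hε
  obtain ⟨K, hK, h⟩ := isTightMeasureSet_iff_exists_isCompact_measure_compl_le.1
    (isTightMeasureSet_singleton (μ := ν)) e he0
  exact ⟨K, hK, (h ν rfl).trans_lt he⟩

/-- modulus -/
lemma exists_modulus {d : ℕ} (f : Rd d → ℝ≥0) (hf : Continuous f) (C : ℝ≥0) (hC : ∀ x, f x ≤ C)
    (K : Set (Rd d)) (hK : IsCompact K) (ε : ℝ≥0) (hε : 0 < ε) :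
    ∃ L : ℝ≥0, L ≠ 0 ∧ ∀ x y, |(f x : ℝ) - f y| ≤
      (ε + Kᶜ.indicator (fun _ => (C : ℝ)) y) + L * dist x y := by
  have h := hK.uniformContinuousAt_of_continuousAt f (fun a _ => hf.continuousAt)
    (Metric.dist_mem_uniformity (show (0:ℝ) < ε from hε))
  obtain ⟨δ, hδ, hδ'⟩ := Metric.mem_uniformity_dist.1 h
  refine ⟨(C + 1) / ⟨δ, hδ.le⟩, ?_, ?_⟩
  · have : (0:ℝ≥0) < ⟨δ, hδ.le⟩ := hδ
    exact (div_pos (by positivity) this).ne'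
  intro x y
  have hfC : |(f x : ℝ) - f y| ≤ C := by
    have h1 : (f x : ℝ) ≤ C := hC x
    have h2 : (f y : ℝ) ≤ C := hC y
    have h3 := (f x).2
    have h4 := (f y).2
    rw [abs_le]; constructor <;> linarith
  have hn : (0:ℝ) ≤ (((C + 1) / ⟨δ, hδ.le⟩ : ℝ≥0) : ℝ) * dist x y := by positivity
  have hi : 0 ≤ Kᶜ.indicator (fun _ => (C : ℝ)) y := indicator_nonneg (fun _ _ => C.2) _
  have hε' : (0:ℝ) < ε := hε
  by_cases hy : y ∈ K
  · by_cases hd : dist x y < δ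
    · have := hδ' (a := y) (b := x) (by rwa [dist_comm]) hy
      simp only [mem_ofPred_eq, NNReal.dist_eq] at this
      rw [abs_sub_comm] at this
      linarith
    · push Not at hd
      have : (C:ℝ) ≤ (((C + 1) / ⟨δ, hδ.le⟩ : ℝ≥0) : ℝ) * dist x y := by
        change (C:ℝ) ≤ (C+1)/δ * dist x y
        rw [div_mul_eq_mul_div, le_div_iff₀ hδ]
        have := C.2
        nlinarith
      linarith
  · have : Kᶜ.indicator (fun _ => (C : ℝ)) y = C := indicator_of_mem hy _
    linarith

lemma forward_lintegral {d : ℕ} (a b p : ℝ) (ha : 0 < a) (hb : 0 < b) (hp : 1 ≤ p)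
    (μ : ℕ → Measure (Rd d)) (ν : Measure (Rd d))
    (hfin : ∀ n, IsFiniteMeasure (μ n)) [IsFiniteMeasure ν]
    (h : Filter.Tendsto (fun n => Wab a b p (μ n) ν) Filter.atTop (nhds 0))
    (f : BoundedContinuousFunction (Rd d) ℝ≥0) :
    Filter.Tendsto (fun n => ∫⁻ x, f x ∂(μ n)) Filter.atTop (nhds (∫⁻ x, f x ∂ν)) := by
  have hne : ∫⁻ x, f x ∂ν ≠ ⊤ := (f.lintegral_lt_top_of_nnreal ν).ne
  rw [ENNReal.tendsto_nhds hne]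
  intro η hη
  obtain ⟨C, hC⟩ : ∃ C : ℝ≥0, ∀ x, f x ≤ C := ⟨nndist f 0, fun x => by
    have := f.dist_coe_le_dist (g := 0) x
    exact NNReal.coe_le_coe.1 (by simpa [NNReal.dist_eq] using this)⟩
  have hη4 : η / 4 ≠ 0 := (ENNReal.div_pos hη.ne' (by simp)).ne'
  obtain ⟨ε, hε, hε'⟩ := ENNReal.exists_nnreal_pos_mul_lt (measure_ne_top ν univ) hη4
  obtain ⟨κ, hκ, hκ'⟩ := ENNReal.exists_nnreal_pos_mul_lt (ENNReal.coe_ne_top (r := C)) hη4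
  obtain ⟨K, hK, hνK⟩ := exists_compact_meas ν κ (by exact_mod_cast hκ)
  obtain ⟨L, hL0, hL⟩ := exists_modulus f f.continuous C hC K hK ε hε
  obtain ⟨r₁, hr₁, hr₁'⟩ := ENNReal.exists_nnreal_pos_mul_lt
    (a := (ENNReal.ofReal a)⁻¹ * (3 * ((ε + C : ℝ≥0) : ℝ≥0∞)))
    (ENNReal.mul_ne_top (by simp [ha]) (ENNReal.mul_ne_top (by simp) ENNReal.coe_ne_top)) hη4
  obtain ⟨r₂, hr₂, hr₂'⟩ := ENNReal.exists_nnreal_pos_mul_lt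
    (a := (ENNReal.ofReal b)⁻¹ * L)
    (ENNReal.mul_ne_top (by simp [hb]) ENNReal.coe_ne_top) hη4
  set r : ℝ≥0∞ := ((min r₁ r₂ : ℝ≥0) : ℝ≥0∞) with hr
  have hrpos : 0 < r := by
    rw [hr]; exact_mod_cast lt_min hr₁ hr₂
  set g : Rd d → ℝ≥0∞ := fun y => ε + Kᶜ.indicator (fun _ => (C : ℝ≥0∞)) y with hgdef
  have hKm : MeasurableSet Kᶜ := hK.measurableSet.compl
  have hg : Measurable g :=
    (measurable_const.indicator hKm).const_add _
  have hgi : ∫⁻ y, g y ∂ν ≤ η / 4 + η / 4 := by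
    rw [hgdef, lintegral_add_left measurable_const, lintegral_const,
      lintegral_indicator_const hKm]
    gcongr
    rw [mul_comm]
    refine le_trans ?_ hκ'.le
    gcongr
  have hreal : ∀ x y, ((f x : ℝ) ≤ f y + ((ε + Kᶜ.indicator (fun _ => (C : ℝ)) y) + L * dist x y))
      ∧ ((f y : ℝ) ≤ f x + ((ε + Kᶜ.indicator (fun _ => (C : ℝ)) y) + L * dist x y)) := by
    intro x y
    have := abs_le.1 (hL x y)
    constructor <;> linarith
  have hconv : ∀ x y : Rd d, ∀ u v : ℝ≥0,
      (u : ℝ) ≤ v + ((ε + Kᶜ.indicator (fun _ => (C : ℝ)) y) + L * dist x y) →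
      (u : ℝ≥0∞) ≤ v + g y + L * edist x y := by
    intro x y u v huv
    have e1 : Kᶜ.indicator (fun _ => (C : ℝ)) y = ((Kᶜ.indicator (fun _ => C) y : ℝ≥0) : ℝ) := by
      by_cases hy : y ∈ Kᶜ <;> simp [indicator, hy]
    have e2 : g y = ((ε + Kᶜ.indicator (fun _ => C) y : ℝ≥0) : ℝ≥0∞) := by
      by_cases hy : y ∈ Kᶜ <;> simp [hgdef, indicator, hy]
    rw [e1, ← coe_nndist] at huv
    rw [e2, edist_nndist, add_assoc]
    exact_mod_cast huv
  filter_upwards [h.eventually (gt_mem_nhds hrpos)] with n hn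
  haveI := hfin n
  obtain ⟨μ', ν', i1, i2, hm, ht, hw⟩ := exists_of_Wab_lt a b p ha hb hp _ _ _ hn
  have := two_sided p hp (μ n) ν μ' ν' hm (fun x => f x) g
    (by exact measurable_coe_nnreal_ennreal.comp f.continuous.measurable) hg L (ε + C : ℝ≥0)
    (by exact_mod_cast hL0) ENNReal.coe_ne_top
    (fun x => by
      have := (hC x).trans (le_add_self : C ≤ ε + C)
      exact_mod_cast this)
    (fun x => by
      rw [ENNReal.coe_add]
      simp only [hgdef]
      gcongr
      exact indicator_le_self _ _ _)
    (fun x y => hconv x y _ _ (hreal x y).1) (fun x y => hconv x y _ _ (hreal x y).2) η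
    (by
      calc _ ≤ (η / 4 + η / 4) + 3 * ((ε + C : ℝ≥0) : ℝ≥0∞) * (r₁ / ENNReal.ofReal a)
            + L * (r₂ / ENNReal.ofReal b) := by
            gcongr
            · refine ht.trans ?_
              gcongr
              rw [hr]
              exact_mod_cast min_le_left _ _
            · refine hw.trans ?_
              gcongr
              rw [hr]
              exact_mod_cast min_le_right _ _
        _ = (η / 4 + η / 4) + r₁ * ((ENNReal.ofReal a)⁻¹ * (3 * ((ε + C : ℝ≥0) : ℝ≥0∞)))
            + r₂ * ((ENNReal.ofReal b)⁻¹ * L) := by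
            rw [div_eq_mul_inv (r₁ : ℝ≥0∞), div_eq_mul_inv (r₂ : ℝ≥0∞)]; ring
        _ ≤ (η / 4 + η / 4) + η / 4 + η / 4 := by gcongr
        _ = 4 * (η / 4) := by ring
        _ = η := ENNReal.mul_div_cancel (by simp) (by simp))
  exact ⟨tsub_le_iff_right.2 this.2, this.1⟩

lemma tight_of_tendsto {d : ℕ} (μ : ℕ → FiniteMeasure (Rd d)) (ν : FiniteMeasure (Rd d))
    (h : Filter.Tendsto μ Filter.atTop (nhds ν)) :
    Tight (Set.range fun n => (μ n : Measure (Rd d))) := by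
  intro ε hε
  obtain ⟨K, hK, hνK⟩ := exists_compact_meas (ν : Measure (Rd d)) ε hε
  obtain ⟨R, hR⟩ := hK.isBounded.subset_ball 0
  have hlim := FiniteMeasure.limsup_measure_closed_le_of_tendsto h
    (F := (Metric.ball (0 : Rd d) R)ᶜ) (Metric.isOpen_ball.isClosed_compl)
  have hlt := hlim.trans_lt ((measure_mono (compl_subset_compl.2 hR)).trans_lt hνK)
  have hev := Filter.eventually_lt_of_limsup_lt hlt
  obtain ⟨N, hN⟩ := Filter.eventually_atTop.1 hev
  choose k hk hk' using fun n => exists_compact_meas (μ n : Measure (Rd d)) ε hε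
  refine ⟨Metric.closedBall 0 R ∪ ⋃ n ∈ Finset.range N, k n,
    (isCompact_closedBall _ _).union ((Finset.range N).isCompact_biUnion fun n _ => hk n), ?_⟩
  rintro _ ⟨n, rfl⟩
  by_cases hn : N ≤ n
  · refine (measure_mono ?_).trans_lt (hN n hn)
    exact compl_subset_compl.2 (Metric.ball_subset_closedBall.trans subset_union_left)
  · refine (measure_mono ?_).trans_lt (hk' n)
    refine compl_subset_compl.2 (Subset.trans ?_ subset_union_right)
    exact subset_biUnion_of_mem (u := k) (by simpa using hn)

lemma Wp_le_of_coupling {d : ℕ} (p : ℝ) (hp : 1 ≤ p) (μ ν : Measure (Rd d)) [IsFiniteMeasure μ]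
    [IsFiniteMeasure ν] (hm : μ univ = ν univ) (γ : Measure (Rd d × Rd d))
    (h1 : γ.map Prod.fst = μ) (h2 : γ.map Prod.snd = ν) (δ : ℝ≥0∞)
    (h : ∀ᵐ q ∂γ, edist q.1 q.2 ≤ δ) : Wp p μ ν ≤ μ univ * δ := by
  have hp0 : 0 < p := by linarith
  by_cases hμ0 : μ univ = 0
  · simp [Wp, hμ0]
  have hμt : μ univ ≠ ⊤ := measure_ne_top _ _
  have hγ : γ univ = μ univ := by
    rw [← h1, Measure.map_apply measurable_fst MeasurableSet.univ, preimage_univ]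
  have hplan : IsPlan μ ν ((μ univ)⁻¹ • γ) := by
    refine ⟨⟨?_⟩, ?_, ?_⟩
    · simp [hγ, ENNReal.inv_mul_cancel hμ0 hμt]
    · rw [Measure.map_smul, h1]
    · rw [Measure.map_smul, h2, hm]
  unfold Wp
  gcongr
  calc (⨅ π : {π : Measure (Rd d × Rd d) // IsPlan μ ν π}, planCost p π.1) ^ (1/p)
      ≤ (δ ^ p) ^ (1/p) := by
        gcongr
        refine (iInf_le _ ⟨_, hplan⟩).trans ?_
        simp only [planCost]
        rw [lintegral_smul_measure, smul_eq_mul]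
        calc (μ univ)⁻¹ * ∫⁻ q, edist q.1 q.2 ^ p ∂γ ≤ (μ univ)⁻¹ * ∫⁻ q, δ ^ p ∂γ := by
              gcongr (μ univ)⁻¹ * ?_
              refine lintegral_mono_ae ?_
              filter_upwards [h] with q hq
              gcongr
          _ = δ ^ p := by
              rw [lintegral_const, hγ, mul_comm (δ ^ p), ← mul_assoc,
                ENNReal.inv_mul_cancel hμ0 hμt, one_mul]
    _ = δ := by rw [← ENNReal.rpow_mul, mul_one_div_cancel hp0.ne', ENNReal.rpow_one]

/-- The reduced measure. -/
def redMeas {d : ℕ} {ι : Type} [Fintype ι] (μ : Measure (Rd d)) (φ : ι → Rd d → ℝ≥0∞)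
    (c : ι → ℝ≥0∞) : Measure (Rd d) :=
  ∑ i, (c i * (∫⁻ x, φ i x ∂μ)⁻¹) • μ.withDensity (φ i)

lemma mass_wd {d : ℕ} (μ : Measure (Rd d)) (φ : Rd d → ℝ≥0∞) :
    μ.withDensity φ univ = ∫⁻ x, φ x ∂μ := by
  rw [withDensity_apply _ MeasurableSet.univ, Measure.restrict_univ]

lemma redMeas_univ {d : ℕ} {ι : Type} [Fintype ι] (μ : Measure (Rd d)) (φ : ι → Rd d → ℝ≥0∞)
    (c : ι → ℝ≥0∞) (hc : ∀ i, c i ≤ ∫⁻ x, φ i x ∂μ) (ht : ∀ i, ∫⁻ x, φ i x ∂μ ≠ ⊤) :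
    redMeas μ φ c univ = ∑ i, c i := by
  simp only [redMeas, Measure.finsetSum_apply, Measure.smul_apply, smul_eq_mul, mass_wd]
  refine Finset.sum_congr rfl fun i _ => ?_
  by_cases h0 : ∫⁻ x, φ i x ∂μ = 0
  · have : c i = 0 := by simpa [h0] using hc i
    simp [this]
  · rw [mul_assoc, ENNReal.inv_mul_cancel h0 (ht i), mul_one]

lemma redMeas_tv {d : ℕ} {ι : Type} [Fintype ι] (μ : Measure (Rd d)) (φ : ι → Rd d → ℝ≥0∞)
    (φ₀ : Rd d → ℝ≥0∞) (hφ : ∀ i, Measurable (φ i)) (hsum : ∀ x, ∑ i, φ i x + φ₀ x = 1)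
    (c : ι → ℝ≥0∞) (hc : ∀ i, c i ≤ ∫⁻ x, φ i x ∂μ) (ht : ∀ i, ∫⁻ x, φ i x ∂μ ≠ ⊤) :
    tv μ (redMeas μ φ c) ≤ ∑ i, (∫⁻ x, φ i x ∂μ - c i) + ∫⁻ x, φ₀ x ∂μ := by
  have key : μ = redMeas μ φ c + (redMeas μ φ (fun i => ∫⁻ x, φ i x ∂μ - c i)
      + μ.withDensity φ₀) := by
    have h1 : redMeas μ φ c + redMeas μ φ (fun i => ∫⁻ x, φ i x ∂μ - c i) =
        ∑ i, μ.withDensity (φ i) := by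
      simp only [redMeas]
      rw [← Finset.sum_add_distrib]
      refine Finset.sum_congr rfl fun i _ => ?_
      rw [← add_smul, ← add_mul, add_tsub_cancel_of_le (hc i)]
      by_cases h0 : ∫⁻ x, φ i x ∂μ = 0
      · have : μ.withDensity (φ i) = 0 := by
          rw [← Measure.measure_univ_eq_zero, mass_wd, h0]
        simp [this]
      · rw [ENNReal.mul_inv_cancel h0 (ht i), one_smul]
    rw [← add_assoc, h1]
    have h2 : ∑ i, μ.withDensity (φ i) = μ.withDensity (fun x => ∑ i, φ i x) := by
      ext s hs
      simp only [Measure.finsetSum_apply, withDensity_apply _ hs]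
      rw [lintegral_finsetSum _ fun i _ => hφ i]
    rw [h2, ← withDensity_add_left (by fun_prop)]
    have : ((fun x => ∑ i, φ i x) + φ₀) = 1 := by
      ext x; exact hsum x
    rw [this, withDensity_one]
  refine (tv_le_of_add _ _ _ key).trans_eq ?_
  rw [Measure.add_apply, redMeas_univ _ _ _ (fun i => tsub_le_self) ht, mass_wd]

lemma Tab_le {d : ℕ} {ι : Type} [Fintype ι] (a b p : ℝ) (hp : 1 ≤ p) (μ ν : Measure (Rd d))
    [IsFiniteMeasure μ] [IsFiniteMeasure ν] (φ : ι → Rd d → ℝ≥0∞)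
    (φ₀ : Rd d → ℝ≥0∞) (hφ : ∀ i, Measurable (φ i)) (hsum : ∀ x, ∑ i, φ i x + φ₀ x = 1)
    (δ : ℝ≥0∞) (hδ : ∀ i x y, φ i x ≠ 0 → φ i y ≠ 0 → edist x y ≤ δ)
    (α β : ι → ℝ≥0∞) (hα : ∀ i, α i = ∫⁻ x, φ i x ∂μ) (hβ : ∀ i, β i = ∫⁻ x, φ i x ∂ν) :
    Tab a b p μ ν ≤ ENNReal.ofReal a ^ p *
      ((∑ i, (α i - min (α i) (β i)) + ∫⁻ x, φ₀ x ∂μ) +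
      (∑ i, (β i - min (α i) (β i)) + ∫⁻ x, φ₀ x ∂ν)) ^ p +
      ENNReal.ofReal b ^ p * (ν univ * δ) ^ p := by
  have hp0 : 0 < p := by linarith
  have hφ1 : ∀ i x, φ i x ≤ 1 := fun i x => by
    rw [← hsum x]
    exact (Finset.single_le_sum (f := fun i => φ i x) (fun _ _ => zero_le) (Finset.mem_univ i)).trans
      le_self_add
  have hfinm : ∀ (μ : Measure (Rd d)) [IsFiniteMeasure μ] i, ∫⁻ x, φ i x ∂μ ≠ ⊤ := by
    intro μ _ i
    refine ((lintegral_mono (hφ1 i)).trans_lt ?_).ne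
    simp
  have hαt : ∀ i, ∫⁻ x, φ i x ∂μ ≠ ⊤ := hfinm μ
  have hβt : ∀ i, ∫⁻ x, φ i x ∂ν ≠ ⊤ := hfinm ν
  set c : ι → ℝ≥0∞ := fun i => min (α i) (β i) with hcdef
  have hcα : ∀ i, c i ≤ ∫⁻ x, φ i x ∂μ := fun i => hα i ▸ min_le_left _ _
  have hcβ : ∀ i, c i ≤ ∫⁻ x, φ i x ∂ν := fun i => hβ i ▸ min_le_right _ _
  have hct : ∀ i, c i ≠ ⊤ := fun i => ((hcα i).trans_lt (hαt i).lt_top).ne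
  have m1 := redMeas_univ μ φ c hcα hαt
  have m2 := redMeas_univ ν φ c hcβ hβt
  have hct' : ∑ i, c i < ⊤ := ENNReal.sum_lt_top.2 fun i _ => (hct i).lt_top
  have i1 : IsFiniteMeasure (redMeas μ φ c) := ⟨by rw [m1]; exact hct'⟩
  have i2 : IsFiniteMeasure (redMeas ν φ c) := ⟨by rw [m2]; exact hct'⟩
  have hwf : ∀ (μ : Measure (Rd d)) [IsFiniteMeasure μ] i, IsFiniteMeasure (μ.withDensity (φ i)) :=
    fun μ _ i => ⟨by rw [mass_wd]; exact (hfinm μ i).lt_top⟩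
  have := hwf μ
  have := hwf ν
  have hW : Wp p (redMeas μ φ c) (redMeas ν φ c) ≤ ν univ * δ := by
    set γ : Measure (Rd d × Rd d) := ∑ i, (c i * (α i)⁻¹ * (β i)⁻¹) •
      ((μ.withDensity (φ i)).prod (ν.withDensity (φ i))) with hγ
    have g1 : γ.map Prod.fst = redMeas μ φ c := by
      rw [hγ, Measure.map_finset_sum (by fun_prop), redMeas]
      refine Finset.sum_congr rfl fun i _ => ?_
      rw [Measure.map_smul, Measure.map_fst_prod, mass_wd, smul_smul, ← hβ, ← hα]
      by_cases h0 : β i = 0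
      · have : c i = 0 := by simp [hcdef, h0]
        simp [this]
      · rw [mul_assoc (c i * _), ENNReal.inv_mul_cancel h0 (hβ i ▸ hβt i), mul_one]
    have g2 : γ.map Prod.snd = redMeas ν φ c := by
      rw [hγ, Measure.map_finset_sum (by fun_prop), redMeas]
      refine Finset.sum_congr rfl fun i _ => ?_
      rw [Measure.map_smul, Measure.map_snd_prod, mass_wd, smul_smul, ← hβ, ← hα]
      by_cases h0 : α i = 0
      · have : c i = 0 := by simp [hcdef, h0]
        simp [this]
      · rw [mul_right_comm (c i), mul_assoc (c i * _), ENNReal.inv_mul_cancel h0 (hα i ▸ hαt i),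
          mul_one]
    have g3 : ∀ᵐ q ∂γ, edist q.1 q.2 ≤ δ := by
      rw [hγ, ← Measure.sum_fintype, Measure.ae_sum_iff]
      intro i
      refine Measure.ae_smul_measure ?_ _
      have k1 : ∀ᵐ x ∂(μ.withDensity (φ i)), φ i x ≠ 0 :=
        (ae_withDensity_iff (hφ i)).2 (by simp)
      have k2 : ∀ᵐ x ∂(ν.withDensity (φ i)), φ i x ≠ 0 :=
        (ae_withDensity_iff (hφ i)).2 (by simp)
      filter_upwards [Measure.quasiMeasurePreserving_fst.ae k1,
        Measure.quasiMeasurePreserving_snd.ae k2] with q h1 h2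
      exact hδ i _ _ h1 h2
    refine (Wp_le_of_coupling p hp _ _ (m1.trans m2.symm) γ g1 g2 δ g3).trans ?_
    rw [m1]
    gcongr
    calc ∑ i, c i ≤ ∑ i, ∫⁻ x, φ i x ∂ν := Finset.sum_le_sum fun i _ => hcβ i
      _ = ∫⁻ x, ∑ i, φ i x ∂ν := (lintegral_finsetSum _ fun i _ => hφ i).symm
      _ ≤ ∫⁻ x, 1 ∂ν := lintegral_mono fun x => by rw [← hsum x]; exact le_self_add
      _ = ν univ := by simp
  unfold Tab
  refine (iInf_le_of_le (redMeas μ φ c) (iInf_le_of_le (redMeas ν φ c) (iInf_le_of_le i1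
    (iInf_le_of_le i2 (iInf_le_of_le (m1.trans m2.symm) le_rfl))))).trans ?_
  have t1 := redMeas_tv μ φ φ₀ hφ hsum c hcα hαt
  have t2 := redMeas_tv ν φ φ₀ hφ hsum c hcβ hβt
  simp only [← hα] at t1
  simp only [← hβ] at t2
  gcongr

lemma exists_pou {d : ℕ} (K : Set (Rd d)) (hK : IsCompact K) (δ : ℝ) (hδ : 0 < δ) :
    ∃ (t : Set (Rd d)) (_ : Fintype t) (ψ : t → Rd d → ℝ≥0), (∀ i, Continuous (ψ i)) ∧
      (∀ x, ∑ i, ψ i x ≤ 1) ∧ (∀ x ∈ K, ∑ i, ψ i x = 1) ∧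
      (∀ i x y, ψ i x ≠ 0 → ψ i y ≠ 0 → edist x y ≤ ENNReal.ofReal δ) := by
  obtain ⟨t, -, htf, hcov⟩ := hK.finite_cover_balls (half_pos hδ)
  letI : Fintype t := htf.fintype
  obtain ⟨f, hf⟩ := PartitionOfUnity.exists_isSubordinate hK.isClosed
    (fun i : t => Metric.ball (i : Rd d) (δ / 2)) (fun i => Metric.isOpen_ball)
    (by simpa [iUnion_subtype] using hcov)
  have hs : ∀ x, ((∑ i, (f i x).toNNReal : ℝ≥0) : ℝ) = ∑ᶠ i, f i x := by
    intro x
    rw [finsum_eq_sum_of_fintype, NNReal.coe_sum]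
    exact Finset.sum_congr rfl fun i _ => Real.coe_toNNReal _ (f.nonneg i x)
  refine ⟨t, inferInstance, fun i x => (f i x).toNNReal, fun i => by fun_prop, ?_, ?_, ?_⟩
  · intro x
    rw [← NNReal.coe_le_coe, hs]
    exact f.sum_le_one x
  · intro x hx
    rw [← NNReal.coe_inj, hs]
    exact f.sum_eq_one hx
  · intro i x y hx hy
    have hb : ∀ z, (f i z).toNNReal ≠ 0 → z ∈ Metric.ball (i : Rd d) (δ / 2) := by
      intro z hz
      refine hf i (subset_tsupport _ ?_)
      intro h0
      exact hz (by simp [h0])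
    rw [edist_dist]
    refine ENNReal.ofReal_le_ofReal ?_
    have h1 := Metric.mem_ball.1 (hb x hx)
    have h2 := Metric.mem_ball'.1 (hb y hy)
    linarith [dist_triangle x (i : Rd d) y]

/-- bounded continuous function from a continuous function bounded by one -/
def mkB {d : ℕ} (f : Rd d → ℝ≥0) (hf : Continuous f) (h1 : ∀ x, f x ≤ 1) :
    BoundedContinuousFunction (Rd d) ℝ≥0 :=
  BoundedContinuousFunction.mkOfBound ⟨f, hf⟩ 1 (fun x y => by
    have a1 : (f x : ℝ) ≤ 1 := h1 x
    have a2 : (f y : ℝ) ≤ 1 := h1 y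
    have a3 := (f x).2
    have a4 := (f y).2
    rw [ContinuousMap.coe_mk, NNReal.dist_eq, abs_le]
    constructor <;> linarith)

lemma Tab_eventually {d : ℕ} (a b p : ℝ) (hp : 1 ≤ p)
    (μ : ℕ → Measure (Rd d)) (ν : Measure (Rd d))
    (hfin : ∀ n, IsFiniteMeasure (μ n)) [IsFiniteMeasure ν]
    (h : ∀ f : BoundedContinuousFunction (Rd d) ℝ≥0,
      Filter.Tendsto (fun n => ∫⁻ x, f x ∂(μ n)) Filter.atTop (nhds (∫⁻ x, f x ∂ν)))
    (κ : ℝ≥0∞) (hκ : 0 < κ) (δ : ℝ) (hδ : 0 < δ) :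
    ∀ᶠ n in Filter.atTop, Tab a b p (μ n) ν ≤ ENNReal.ofReal a ^ p * (2 * κ) ^ p +
      ENNReal.ofReal b ^ p * (ν univ * ENNReal.ofReal δ) ^ p := by
  obtain ⟨K, hK, hνK⟩ := exists_compact_meas ν κ hκ
  obtain ⟨t, _, ψ, hψc, hψ1, hψK, hψδ⟩ := exists_pou K hK δ hδ
  set ψ₀ : Rd d → ℝ≥0 := fun x => 1 - ∑ i, ψ i x with hψ₀
  have hψ₀c : Continuous ψ₀ := by fun_prop
  have hi1 : ∀ i x, ψ i x ≤ 1 := fun i x =>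
    (Finset.single_le_sum (f := fun i => ψ i x) (fun _ _ => zero_le) (Finset.mem_univ i)).trans
      (hψ1 x)
  have l0 : Filter.Tendsto (fun n => ∫⁻ x, ψ₀ x ∂(μ n)) Filter.atTop (nhds (∫⁻ x, ψ₀ x ∂ν)) :=
    h (mkB ψ₀ hψ₀c (fun x => tsub_le_self))
  have li : ∀ i, Filter.Tendsto (fun n => ∫⁻ x, ψ i x ∂(μ n)) Filter.atTop
      (nhds (∫⁻ x, ψ i x ∂ν)) := fun i => h (mkB (ψ i) (hψc i) (hi1 i))
  have hβt : ∀ i, ∫⁻ x, ψ i x ∂ν ≠ ⊤ := fun i =>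
    ((mkB (ψ i) (hψc i) (hi1 i)).lintegral_lt_top_of_nnreal ν).ne
  have h0κ : ∫⁻ x, ψ₀ x ∂ν < κ := by
    refine lt_of_le_of_lt ?_ hνK
    rw [← lintegral_indicator_one hK.measurableSet.compl]
    refine lintegral_mono fun x => ?_
    by_cases hx : x ∈ K
    · simp [hψ₀, hψK x hx]
    · have : x ∈ Kᶜ := hx
      rw [indicator_of_mem this, Pi.one_apply]
      have h1 : ψ₀ x ≤ 1 := tsub_le_self
      exact ENNReal.coe_le_one_iff.2 h1
  have lmin : ∀ i, Filter.Tendsto (fun n => min (∫⁻ x, ψ i x ∂(μ n)) (∫⁻ x, ψ i x ∂ν))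
      Filter.atTop (nhds (∫⁻ x, ψ i x ∂ν)) := fun i => by
    simpa using (li i).min (tendsto_const_nhds (x := ∫⁻ x, ψ i x ∂ν))
  have lim : Filter.Tendsto (fun n =>
      (∑ i, (∫⁻ x, ψ i x ∂(μ n) - min (∫⁻ x, ψ i x ∂(μ n)) (∫⁻ x, ψ i x ∂ν)) + ∫⁻ x, ψ₀ x ∂(μ n)) +
      (∑ i, (∫⁻ x, ψ i x ∂ν - min (∫⁻ x, ψ i x ∂(μ n)) (∫⁻ x, ψ i x ∂ν)) + ∫⁻ x, ψ₀ x ∂ν))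
      Filter.atTop (nhds ((∑ i : t, (∫⁻ x, ψ i x ∂ν - ∫⁻ x, ψ i x ∂ν) + ∫⁻ x, ψ₀ x ∂ν) +
        (∑ i : t, (∫⁻ x, ψ i x ∂ν - ∫⁻ x, ψ i x ∂ν) + ∫⁻ x, ψ₀ x ∂ν))) := by
    refine ((tendsto_finsetSum _ fun i _ => ?_).add l0).add
      ((tendsto_finsetSum _ fun i _ => ?_).add tendsto_const_nhds)
    · exact ENNReal.Tendsto.sub (li i) (lmin i) (Or.inl (hβt i))
    · exact ENNReal.Tendsto.sub tendsto_const_nhds (lmin i) (Or.inl (hβt i))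
  simp only [tsub_self, Finset.sum_const_zero, zero_add] at lim
  have hlt : ∫⁻ x, ψ₀ x ∂ν + ∫⁻ x, ψ₀ x ∂ν < 2 * κ := by
    rw [two_mul]; exact ENNReal.add_lt_add h0κ h0κ
  filter_upwards [lim.eventually (gt_mem_nhds hlt)] with n hn
  haveI := hfin n
  refine (Tab_le a b p hp (μ n) ν (fun i x => (ψ i x : ℝ≥0∞)) (fun x => (ψ₀ x : ℝ≥0∞))
    (fun i => measurable_coe_nnreal_ennreal.comp (hψc i).measurable) ?_ (ENNReal.ofReal δ) ?_ _ _
    (fun i => rfl) (fun i => rfl)).trans ?_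
  · intro x
    have : ∑ i, ψ i x + ψ₀ x = 1 := add_tsub_cancel_of_le (hψ1 x)
    exact_mod_cast this
  · intro i x y hx hy
    exact hψδ i x y (by exact_mod_cast hx) (by exact_mod_cast hy)
  · have hp0 : 0 ≤ p := by linarith
    gcongr

lemma Tab_tendsto {d : ℕ} (a b p : ℝ) (hp : 1 ≤ p)
    (μ : ℕ → Measure (Rd d)) (ν : Measure (Rd d))
    (hfin : ∀ n, IsFiniteMeasure (μ n)) [IsFiniteMeasure ν]
    (h : ∀ f : BoundedContinuousFunction (Rd d) ℝ≥0,
      Filter.Tendsto (fun n => ∫⁻ x, f x ∂(μ n)) Filter.atTop (nhds (∫⁻ x, f x ∂ν))) :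
    Filter.Tendsto (fun n => Tab a b p (μ n) ν) Filter.atTop (nhds 0) := by
  have hp0 : 0 < p := by linarith
  -- the bound tends to zero
  have hB : Filter.Tendsto (fun s : ℝ => ENNReal.ofReal a ^ p * (2 * ENNReal.ofReal s) ^ p +
      ENNReal.ofReal b ^ p * (ν univ * ENNReal.ofReal s) ^ p) (nhdsWithin 0 (Ioi 0)) (nhds 0) := by
    have hs : Filter.Tendsto (fun s : ℝ => ENNReal.ofReal s) (nhdsWithin 0 (Ioi 0)) (nhds 0) := by
      have := (ENNReal.continuous_ofReal.tendsto 0).mono_left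
        (nhdsWithin_le_nhds (s := Ioi (0:ℝ)))
      simpa using this
    have key : ∀ A c : ℝ≥0∞, A ≠ ⊤ → c ≠ ⊤ → Filter.Tendsto
        (fun s : ℝ => A * (c * ENNReal.ofReal s) ^ p) (nhdsWithin 0 (Ioi 0)) (nhds 0) := by
      intro A c hA hc
      have h1 := ENNReal.Tendsto.const_mul hs (Or.inr hc)
      have h2 := (ENNReal.continuous_rpow_const (y := p)).tendsto _ |>.comp h1
      have h3 := ENNReal.Tendsto.const_mul h2 (Or.inr hA)
      simpa [ENNReal.zero_rpow_of_pos hp0, Function.comp_def] using h3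
    have := (key (ENNReal.ofReal a ^ p) 2 (by simp [hp0.le]) (by simp)).add
      (key (ENNReal.ofReal b ^ p) (ν univ) (by simp [hp0.le]) (measure_ne_top _ _))
    simpa using this
  rw [ENNReal.tendsto_nhds_zero]
  intro η hη
  obtain ⟨s, hs, hs0⟩ := ((hB.eventually (gt_mem_nhds hη)).and self_mem_nhdsWithin).exists
  have hs0 : 0 < s := hs0
  filter_upwards [Tab_eventually a b p hp μ ν hfin h (ENNReal.ofReal s) (by simpa using hs0) s hs0]
    with n hn
  exact hn.trans hs.le

/-- convergence in `W_p^{a,b}` is equivalent to weak-* convergence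
plus tightness. -/
theorem Wab_convergence_iff {d : ℕ} (a b p : ℝ) (ha : 0 < a) (hb : 0 < b) (hp : 1 ≤ p)
    (μ : ℕ → Measure (Rd d)) (ν : Measure (Rd d))
    (hfin : ∀ n, IsFiniteMeasure (μ n)) [IsFiniteMeasure ν] :
    Filter.Tendsto (fun n => Wab a b p (μ n) ν) Filter.atTop (nhds 0) ↔
      ((∀ f : BoundedContinuousFunction (Rd d) ℝ,
          Filter.Tendsto (fun n => ∫ x, f x ∂(μ n)) Filter.atTop (nhds (∫ x, f x ∂ν))) ∧
        Tight (Set.range μ)) := by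
  have hp0 : 0 < p := by linarith
  let M : ℕ → FiniteMeasure (Rd d) := fun n => ⟨μ n, hfin n⟩
  let N : FiniteMeasure (Rd d) := ⟨ν, inferInstance⟩
  have hiff : (∀ f : BoundedContinuousFunction (Rd d) ℝ,
      Filter.Tendsto (fun n => ∫ x, f x ∂(μ n)) Filter.atTop (nhds (∫ x, f x ∂ν))) ↔
      Filter.Tendsto M Filter.atTop (nhds N) :=
    (FiniteMeasure.tendsto_iff_forall_integral_tendsto (μs := M) (μ := N)).symm
  rw [hiff]
  constructor
  · intro h
    have hw : Filter.Tendsto M Filter.atTop (nhds N) :=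
      FiniteMeasure.tendsto_iff_forall_lintegral_tendsto.2
        (forward_lintegral a b p ha hb hp μ ν hfin h)
    exact ⟨hw, tight_of_tendsto M N hw⟩
  · rintro ⟨h, -⟩
    have h1 := Tab_tendsto a b p hp μ ν hfin
      (FiniteMeasure.tendsto_iff_forall_lintegral_tendsto.1 h)
    have h2 := ((ENNReal.continuous_rpow_const (y := 1 / p)).tendsto 0).comp h1
    rw [ENNReal.zero_rpow_of_pos (by positivity)] at h2
    exact h2
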